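/- Let γ ≥ 2 be an even integer and let ξ be a real number with 0 < ξ < π/2. Then (2/π) ∫_{I₂} sin²θ dθ = 1 − 2ξ/π. -/

import Mathlib

open Real MeasureTheory

/-- The interval `A(j) = [(2πj + ξ)/(γ+1), (2πj + π − ξ)/(γ+1)]`. -/
noncomputable def Aint (γ : ℕ) (ξ : ℝ) (j : ℕ) : Set ℝ :=
  Set.Icc ((2 * π * j + ξ) / ((γ : ℝ) + 1)) ((2 * π * j + π - ξ) / ((γ : ℝ) + 1))

/-- The interval `B(j) = [(2πj + π + ξ)/(γ+1), (2πj + 2π − ξ)/(γ+1)]`. -/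
noncomputable def Bint (γ : ℕ) (ξ : ℝ) (j : ℕ) : Set ℝ :=
  Set.Icc ((2 * π * j + π + ξ) / ((γ : ℝ) + 1)) ((2 * π * j + 2 * π - ξ) / ((γ : ℝ) + 1))

/-- The sines of `n ≥ 2` equally spaced angles around the circle sum to zero. -/
theorem sum_sin_add_two_pi_mul_div_eq_zero (n : ℕ) (hn : 2 ≤ n) (a : ℝ) :
    ∑ k ∈ Finset.range n, sin (a + 2 * π * k / n) = 0 := by
  have hn2 : (2 : ℝ) ≤ n := by exact_mod_cast hn
  have hn0 : (n : ℝ) ≠ 0 := by positivity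
  have hs : 0 < sin (π / n) :=
    sin_pos_of_pos_of_lt_pi (by positivity) (div_lt_self pi_pos (by linarith))
  have h := Finset.sum_range_sub' (fun k : ℕ => cos (a + 2 * π * k / n - π / n)) n
  have hper : cos (a + 2 * π * (n : ℕ) / n - π / n) = cos (a + 2 * π * (0 : ℕ) / n - π / n) := by
    rw [← cos_add_two_pi (a + 2 * π * (0 : ℕ) / n - π / n)]
    congr 1
    push_cast
    field_simp
    ring
  rw [hper, sub_self] at h
  have key : ∀ k : ℕ, cos (a + 2 * π * k / n - π / n) - cos (a + 2 * π * (k + 1 : ℕ) / n - π / n) =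
      2 * sin (π / n) * sin (a + 2 * π * k / n) := by
    intro k
    have e : a + 2 * π * (k + 1 : ℕ) / n - π / n = a + 2 * π * k / n + π / n := by
      push_cast
      ring
    rw [e, cos_sub, cos_add _ (π / n)]
    ring
  simp only [key, ← Finset.mul_sum] at h
  exact (mul_eq_zero.mp h).resolve_left (by positivity)

/-- Alternately indexed unions: the even and odd members of a family reassemble. -/
theorem biUnion_range_even_union_odd {α : Type*} (J : ℕ → Set α) (m : ℕ) :
    ((⋃ j ∈ Finset.range m, (J (2 * j) ∪ J (2 * j + 1))) ∪ J (2 * m)) =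
      ⋃ k ∈ Finset.range (2 * m + 1), J k := by
  ext x
  simp only [Set.mem_union, Set.mem_iUnion, Finset.mem_range, exists_prop]
  constructor
  · rintro (⟨j, hj, h | h⟩ | h)
    · exact ⟨2 * j, by omega, h⟩
    · exact ⟨2 * j + 1, by omega, h⟩
    · exact ⟨2 * m, by omega, h⟩
  · rintro ⟨k, hk, h⟩
    rcases Nat.even_or_odd' k with ⟨j, rfl | rfl⟩
    · rcases (show j ≤ m by omega).lt_or_eq with hj | rfl
      · exact Or.inl ⟨j, hj, Or.inl h⟩
      · exact Or.inr h
    · exact Or.inl ⟨j, by omega, Or.inr h⟩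

/-- The integral of `sin ^ 2` over the `n` shrunken arcs
`[(πk + ξ)/n, (πk + π - ξ)/n]`, `k < n`. -/
theorem setIntegral_sin_sq_biUnion_Icc (n : ℕ) (hn : 2 ≤ n) (ξ : ℝ) (hξ0 : 0 < ξ)
    (hξ : ξ < π / 2) :
    ∫ θ in ⋃ k ∈ Finset.range n, Set.Icc ((π * k + ξ) / n) ((π * k + π - ξ) / n), sin θ ^ 2 =
      π / 2 - ξ := by
  have hn0 : (0 : ℝ) < n := by positivity
  rw [integral_biUnion_finset]
  · have key : ∀ k : ℕ, ∫ θ in Set.Icc ((π * k + ξ) / n) ((π * k + π - ξ) / n), sin θ ^ 2 =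
        (π / 2 - ξ) / n + (sin (2 * ξ / n + 2 * π * k / n) / 4 -
          sin ((2 * π - 2 * ξ) / n + 2 * π * k / n) / 4) := by
      intro k
      rw [integral_Icc_eq_integral_Ioc, ← intervalIntegral.integral_of_le, integral_sin_sq,
        show 2 * ξ / n + 2 * π * k / n = 2 * ((π * k + ξ) / n) by ring,
        show (2 * π - 2 * ξ) / n + 2 * π * k / n = 2 * ((π * k + π - ξ) / n) by ring,
        sin_two_mul, sin_two_mul]
      · ring
      · gcongr
        linarith
    simp only [key, Finset.sum_add_distrib, Finset.sum_sub_distrib, ← Finset.sum_div,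
      sum_sin_add_two_pi_mul_div_eq_zero n hn, Finset.sum_const, Finset.card_range, nsmul_eq_mul]
    field_simp
    ring
  · intro k _
    exact measurableSet_Icc
  · have hlt : ∀ k l : ℕ, k < l → Disjoint (Set.Icc ((π * k + ξ) / n) ((π * k + π - ξ) / n))
        (Set.Icc ((π * l + ξ) / n) ((π * l + π - ξ) / n)) := by
      intro k l hkl
      have hkl' : (k : ℝ) + 1 ≤ l := by exact_mod_cast hkl
      have h : (π * k + π - ξ) / n < (π * l + ξ) / n := by
        gcongr
        nlinarith [mul_le_mul_of_nonneg_left hkl' pi_pos.le]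
      rw [Set.disjoint_left]
      intro x hx hx'
      exact absurd (hx'.1.trans hx.2) (not_le.mpr h)
    intro k _ l _ hkl
    rcases hkl.lt_or_gt with h | h
    · exact hlt k l h
    · exact (hlt l k h).symm
  · intro k _
    exact (continuous_sin.pow 2).continuousOn.integrableOn_Icc

/-- For `γ ≥ 2` even and `0 < ξ < π/2`, the Sato–Tate measure of
`I₂ = ⋃_{j=0}^{(γ−2)/2} (A(j) ∪ B(j)) ∪ A(γ/2)` is
`(2/π) ∫_{I₂} sin²θ dθ = 1 − 2ξ/π`. -/
theorem satoTate_measure_I2 (γ : ℕ) (hγeven : Even γ) (hγ : 2 ≤ γ) (ξ : ℝ)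
    (hξ0 : 0 < ξ) (hξ : ξ < π / 2) :
    2 / π *
        ∫ θ in ((⋃ j ∈ Finset.range ((γ - 2) / 2 + 1), (Aint γ ξ j ∪ Bint γ ξ j)) ∪
            Aint γ ξ (γ / 2)),
          Real.sin θ ^ 2
      = 1 - 2 * ξ / π := by
  obtain ⟨m, rfl⟩ := hγeven.exists_two_nsmul
  simp only [smul_eq_mul] at *
  have hA : ∀ j, Aint (2 * m) ξ j = Set.Icc ((π * (2 * j : ℕ) + ξ) / (2 * m + 1 : ℕ))
      ((π * (2 * j : ℕ) + π - ξ) / (2 * m + 1 : ℕ)) := by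
    intro j
    unfold Aint
    push_cast
    congr 2 <;> ring
  have hB : ∀ j, Bint (2 * m) ξ j = Set.Icc ((π * (2 * j + 1 : ℕ) + ξ) / (2 * m + 1 : ℕ))
      ((π * (2 * j + 1 : ℕ) + π - ξ) / (2 * m + 1 : ℕ)) := by
    intro j
    unfold Bint
    push_cast
    congr 2 <;> ring
  rw [show (2 * m - 2) / 2 + 1 = m by omega, show 2 * m / 2 = m by omega]
  simp only [hA, hB]
  rw [biUnion_range_even_union_odd (fun k : ℕ => Set.Icc ((π * k + ξ) / (2 * m + 1 : ℕ))
      ((π * k + π - ξ) / (2 * m + 1 : ℕ))) m,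
    setIntegral_sin_sq_biUnion_Icc (2 * m + 1) (by omega) ξ hξ0 hξ]
  field_simp
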